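/- Let n ≥ 1, N = 2n+1, and let σ_n be the Chafee–Infante permutation of {1,…,N}. Define z : {1,…,N} × {1,…,N} → ℤ by z(p,q) = min(min(p−1, N−p), min(q−1, N−q)) for p ≠ q and z(p,p) = min(p−1, N−p). Then z satisfies the zero-number recursion (1.7c) of the paper for σ = σ_n, namely: (a) z(k,k) = i_k, the k-th Morse index of σ_n; (b) z(1,k) = z(N,k) = 0 for all k; (c) for all 1 ≤ j ≤ N−1 and all k with j ≠ k and j+1 ≠ k, 2·(z(j+1,k) − z(j,k)) = (−1)^{j+1}·(sign(σ_n^{−1}(j+1) − σ_n^{−1}(k)) − sign(σ_n^{−1}(j) − σ_n^{−1}(k))). -/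

import Mathlib

/-- The Morse index sequence `(i_k)` of a permutation `σ` (1-based indexing):
`i_1 = 0` and `i_{k+1} = i_k + (−1)^{k+1} · sign(σ⁻¹(k+1) − σ⁻¹(k))`. -/
def morseSeq (σ : Equiv.Perm ℕ) : ℕ → ℤ
  | 0 => 0
  | 1 => 0
  | (k + 2) => morseSeq σ (k + 1) +
      (-1 : ℤ) ^ (k + 2) * Int.sign ((σ.symm (k + 2) : ℤ) - (σ.symm (k + 1) : ℤ))

/-- The Chafee–Infante map on `{1,…,2n+1}`: `k ↦ k` for odd `k`,
`k ↦ 2n+2−k` for even `k`; identity outside `{1,…,2n+1}`. -/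
def CIfun (n : ℕ) : ℕ → ℕ := fun k =>
  if k % 2 = 0 ∧ 1 ≤ k ∧ k ≤ 2 * n + 1 then 2 * n + 2 - k else k

theorem CIfun_involutive (n : ℕ) : Function.Involutive (CIfun n) := by
  intro k
  unfold CIfun
  split_ifs <;> omega

/-- The Chafee–Infante permutation `σ_n` of `{1,…,2n+1}`,
`σ_n = (2 2n)(4 2n−2)⋯` in cycle notation. -/
def CIperm (n : ℕ) : Equiv.Perm ℕ := (CIfun_involutive n).toPerm

/-- The zero numbers of the Chafee–Infante attractor, `N = 2n+1`:
`z(p,q) = min(min(p−1, N−p), min(q−1, N−q))` for `p ≠ q`, and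
`z(p,p) = min(p−1, N−p)`. -/
def zCI (n : ℕ) (p q : ℕ) : ℤ :=
  if p = q then min ((p : ℤ) - 1) (((2 * n + 1 : ℕ) : ℤ) - p)
  else min (min ((p : ℤ) - 1) (((2 * n + 1 : ℕ) : ℤ) - p))
           (min ((q : ℤ) - 1) (((2 * n + 1 : ℕ) : ℤ) - q))

theorem CIperm_symm_apply (n k : ℕ) : (CIperm n).symm k = CIfun n k := rfl

theorem sign_cases (x : ℤ) :
    (0 < x ∧ Int.sign x = 1) ∨ (x = 0 ∧ Int.sign x = 0) ∨ (x < 0 ∧ Int.sign x = -1) := by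
  rcases lt_trichotomy x 0 with h | h | h
  · exact Or.inr (Or.inr ⟨h, Int.sign_eq_neg_one_of_neg h⟩)
  · subst h; simp
  · exact Or.inl ⟨h, Int.sign_eq_one_of_pos h⟩

theorem CIfun_cases (n k : ℕ) (h1 : 1 ≤ k) (h2 : k ≤ 2 * n + 1) :
    (k % 2 = 0 ∧ (CIfun n k : ℤ) = 2 * n + 2 - k) ∨ (k % 2 = 1 ∧ (CIfun n k : ℤ) = k) := by
  unfold CIfun
  split_ifs <;> omega

theorem pow_cases (k : ℕ) :
    (k % 2 = 0 ∧ (-1 : ℤ) ^ k = 1) ∨ (k % 2 = 1 ∧ (-1 : ℤ) ^ k = -1) := by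
  rcases Nat.even_or_odd k with h | h
  · exact Or.inl ⟨Nat.even_iff.mp h, h.neg_one_pow⟩
  · exact Or.inr ⟨Nat.odd_iff.mp h, h.neg_one_pow⟩

/-- For the Chafee–Infante permutation `σ_n` of `{1,…,N}`, `N = 2n+1`, the
zero numbers `zCI` satisfy the recursion (1.7c):
(a) `z(k,k) = i_k`; (b) `z(1,k) = z(N,k) = 0`;
(c) `2·(z(j+1,k) − z(j,k)) = (−1)^{j+1}·(sign(σ⁻¹(j+1) − σ⁻¹(k)) − sign(σ⁻¹(j) − σ⁻¹(k)))`
for `j ≠ k` and `j + 1 ≠ k`. -/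
theorem chafeeInfante_zeroNumber_recursion (n : ℕ) (hn : 1 ≤ n) :
    (∀ k : ℕ, 1 ≤ k → k ≤ 2 * n + 1 → zCI n k k = morseSeq (CIperm n) k) ∧
    (∀ k : ℕ, 1 ≤ k → k ≤ 2 * n + 1 → zCI n 1 k = 0 ∧ zCI n (2 * n + 1) k = 0) ∧
    (∀ j k : ℕ, 1 ≤ j → j ≤ 2 * n → 1 ≤ k → k ≤ 2 * n + 1 → j ≠ k → j + 1 ≠ k →
      2 * (zCI n (j + 1) k - zCI n j k) =
        (-1 : ℤ) ^ (j + 1) *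
          (Int.sign (((CIperm n).symm (j + 1) : ℤ) - ((CIperm n).symm k : ℤ)) -
           Int.sign (((CIperm n).symm j : ℤ) - ((CIperm n).symm k : ℤ)))) := by
  refine ⟨?_, ?_, ?_⟩
  · intro k h1
    induction k, h1 using Nat.le_induction with
    | base => intro _; simp [zCI, morseSeq]
    | succ k hk ih =>
      intro h2
      have ih := ih (by omega)
      obtain ⟨m, rfl⟩ : ∃ m, k = m + 1 := ⟨k - 1, by omega⟩
      rw [show m + 1 + 1 = m + 2 from rfl] at *
      rw [morseSeq, ← ih, CIperm_symm_apply, CIperm_symm_apply]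
      have a := CIfun_cases n (m + 2) (by omega) h2
      have b := CIfun_cases n (m + 1) (by omega) (by omega)
      have c := sign_cases ((CIfun n (m + 2) : ℤ) - (CIfun n (m + 1) : ℤ))
      simp only [zCI, if_true]
      rcases pow_cases (m + 2) with ⟨p, q⟩ | ⟨p, q⟩ <;> rw [q] <;> push_cast at * <;> omega
  · intro k h1 h2
    unfold zCI
    constructor <;> split_ifs <;> push_cast <;> omega
  · intro j k h1 h2 h3 h4 h5 h6
    rw [CIperm_symm_apply, CIperm_symm_apply, CIperm_symm_apply]
    have a := CIfun_cases n (j + 1) (by omega) (by omega)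
    have b := CIfun_cases n j (by omega) (by omega)
    have c := CIfun_cases n k (by omega) (by omega)
    have d := sign_cases ((CIfun n (j + 1) : ℤ) - (CIfun n k : ℤ))
    have e := sign_cases ((CIfun n j : ℤ) - (CIfun n k : ℤ))
    simp only [zCI, if_neg h5, if_neg h6]
    generalize Int.sign ((CIfun n (j + 1) : ℤ) - (CIfun n k : ℤ)) = s at *
    generalize Int.sign ((CIfun n j : ℤ) - (CIfun n k : ℤ)) = t at *
    generalize (CIfun n (j + 1) : ℤ) = u at *
    generalize (CIfun n j : ℤ) = v at *
    generalize (CIfun n k : ℤ) = w at *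
    rcases pow_cases (j + 1) with ⟨p, q⟩ | ⟨p, q⟩ <;> rw [q] <;> push_cast at * <;>
    rcases a with ⟨a, rfl⟩ | ⟨a, rfl⟩ <;> rcases b with ⟨b, rfl⟩ | ⟨b, rfl⟩ <;> try omega
    all_goals
      rcases c with ⟨c, rfl⟩ | ⟨c, rfl⟩ <;> rcases d with ⟨d, rfl⟩ | ⟨d, rfl⟩ | ⟨d, rfl⟩ <;>
        rcases e with ⟨e, rfl⟩ | ⟨e, rfl⟩ | ⟨e, rfl⟩ <;> omega
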